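/- There is no π_{2,2}-invariant Borel probability measure θ on [0,1] (with the Euclidean metric) such that θ({0}) = 0 while every open neighborhood of 0 has positive θ-measure (i.e. 0 lies in the support of θ but is not an atom). -/

import Mathlib

open MeasureTheory
open scoped ENNReal

/-- The transition kernel `K^{θ,2,2}(x,A)`: step to the farther of two i.i.d. `θ`-samples,
ties broken uniformly. -/
noncomputable def K22 {S : Type*} [MetricSpace S] [MeasurableSpace S]
    (θ : Measure S) (x : S) (A : Set S) : ℝ≥0∞ :=
  ∫⁻ y in A, (2 * θ {z | dist x z < dist x y} + θ {z | dist x z = dist x y}) ∂θ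

/-- The pairs `(x, z)` for which `z` is closer to `x` than every point of `[0, δ]`. -/
def closerThanInitial (δ : ℝ) : Set (unitInterval × unitInterval) :=
  {p | δ < p.2 ∧ (p.2 : ℝ) < 2 * p.1 - δ}

lemma measurableSet_closerThanInitial (δ : ℝ) : MeasurableSet (closerThanInitial δ) := by
  have h₁ : Measurable fun p : unitInterval × unitInterval => (p.1 : ℝ) := by fun_prop
  have h₂ : Measurable fun p : unitInterval × unitInterval => (p.2 : ℝ) := by fun_prop
  exact (measurableSet_lt measurable_const h₂).inter
    (measurableSet_lt h₂ ((h₁.const_mul 2).sub_const δ))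

lemma closerThanInitial_anti : Antitone closerThanInitial := by
  rintro a b hab p ⟨h₁, h₂⟩
  exact ⟨by linarith, by linarith⟩

/-- Invariance of `θ` bounds the mass of the pairs in `closerThanInitial δ`. -/
lemma two_mul_prod_closerThanInitial_le_one (θ : Measure unitInterval) [IsProbabilityMeasure θ]
    (hinv : ∀ A : Set unitInterval, MeasurableSet A → θ A = ∫⁻ x, K22 θ x A ∂θ)
    (hsupp : ∀ U : Set unitInterval, IsOpen U → (0 : unitInterval) ∈ U → 0 < θ U)
    {δ : ℝ} (hδ : 0 < δ) : 2 * (θ.prod θ) (closerThanInitial δ) ≤ 1 := by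
  have hopen : IsOpen {y : unitInterval | (y : ℝ) < δ} :=
    isOpen_lt continuous_subtype_val continuous_const
  set A := {y : unitInterval | (y : ℝ) < δ} with hA
  have hpos : 0 < θ A := hsupp A hopen (by simpa [hA] using hδ)
  have hK : ∀ x, 2 * θ (Prod.mk x ⁻¹' closerThanInitial δ) * θ A ≤ K22 θ x A := by
    intro x
    rw [K22, ← setLIntegral_const]
    refine setLIntegral_mono' hopen.measurableSet fun y hy => le_add_right ?_
    gcongr
    rintro z ⟨h₁, h₂⟩
    have hy' : (y : ℝ) < δ := hy
    have h₃ : |(x : ℝ) - z| < |(x : ℝ) - y| :=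
      (abs_lt.2 ⟨by linarith, by linarith⟩ : |(x : ℝ) - z| < x - y).trans_le (le_abs_self _)
    simpa [Subtype.dist_eq, Real.dist_eq] using h₃
  have hmeas : Measurable fun x => θ (Prod.mk x ⁻¹' closerThanInitial δ) :=
    measurable_measure_prodMk_left (measurableSet_closerThanInitial δ)
  have hle : 2 * (θ.prod θ) (closerThanInitial δ) * θ A ≤ 1 * θ A := by
    calc 2 * (θ.prod θ) (closerThanInitial δ) * θ A
        = ∫⁻ x, 2 * θ (Prod.mk x ⁻¹' closerThanInitial δ) * θ A ∂θ := by
          rw [lintegral_mul_const _ (hmeas.const_mul 2), lintegral_const_mul _ hmeas,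
            Measure.prod_apply (measurableSet_closerThanInitial δ)]
      _ ≤ ∫⁻ x, K22 θ x A ∂θ := lintegral_mono hK
      _ = 1 * θ A := by rw [← hinv A hopen.measurableSet, one_mul]
  exact (ENNReal.mul_le_mul_iff_left hpos.ne' (measure_ne_top θ A)).1 hle

/-- Some dyadic annulus around `0` is charged by a measure without an atom at `0`. -/
lemma exists_measure_dyadic_pos (θ : Measure unitInterval) [IsProbabilityMeasure θ]
    (h0 : θ {(0 : unitInterval)} = 0) :
    ∃ k : ℕ, 0 < θ {x | (1 / 2 : ℝ) ^ (k + 1) < x ∧ (x : ℝ) ≤ (1 / 2) ^ k} := by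
  by_contra! h
  have hcover : (Set.univ : Set unitInterval) ⊆
      {0} ∪ ⋃ k : ℕ, {x | (1 / 2 : ℝ) ^ (k + 1) < x ∧ (x : ℝ) ≤ (1 / 2) ^ k} := by
    intro x _
    rcases eq_or_ne x 0 with rfl | hx
    · exact Or.inl rfl
    · obtain ⟨k, hk⟩ := exists_nat_pow_near_of_lt_one (unitInterval.pos_iff_ne_zero.2 hx)
        x.2.2 (by norm_num : (0 : ℝ) < 1 / 2) (by norm_num)
      exact Or.inr (Set.mem_iUnion.2 ⟨k, hk⟩)
  have hnull := measure_mono_null hcover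
    (measure_union_null h0 (measure_iUnion_null fun k => nonpos_iff_eq_zero.1 (h k)))
  simp at hnull

/-- Without an atom at `0`, independent samples `X, Z` of `θ` satisfy `0 < Z < 2 X` with
probability greater than one half. -/
lemma one_lt_two_mul_prod_closerThanInitial_zero (θ : Measure unitInterval)
    [IsProbabilityMeasure θ] (h0 : θ {(0 : unitInterval)} = 0) :
    1 < 2 * (θ.prod θ) (closerThanInitial 0) := by
  obtain ⟨k, hk⟩ := exists_measure_dyadic_pos θ h0
  set J := {x : unitInterval | (1 / 2 : ℝ) ^ (k + 1) < x ∧ (x : ℝ) ≤ (1 / 2) ^ k}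
  have hW := measurableSet_closerThanInitial 0
  set W := closerThanInitial 0
  have hswap : (θ.prod θ) (Prod.swap ⁻¹' W) = (θ.prod θ) W :=
    Measure.measurePreserving_swap.measure_preimage hW.nullMeasurableSet
  have hunion : (θ.prod θ) (W ∪ Prod.swap ⁻¹' W) = 1 := by
    rw [← prob_compl_eq_zero_iff (hW.union (measurable_swap hW))]
    refine measure_mono_null
      (t := ({0} ×ˢ Set.univ : Set (unitInterval × unitInterval)) ∪ Set.univ ×ˢ {0}) ?_
      (measure_union_null (by simp [Measure.prod_prod, h0]) (by simp [Measure.prod_prod, h0]))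
    rintro ⟨x, z⟩ hxz
    by_contra hne
    simp only [Set.mem_union, Set.mem_prod, Set.mem_singleton_iff, Set.mem_univ, and_true,
      true_and, not_or] at hne
    have hx : (0 : ℝ) < x := unitInterval.pos_iff_ne_zero.2 hne.1
    have hz : (0 : ℝ) < z := unitInterval.pos_iff_ne_zero.2 hne.2
    refine hxz ?_
    rcases le_total (z : ℝ) x with h | h
    · exact Or.inl ⟨hz, show (z : ℝ) < 2 * x - 0 by linarith⟩
    · exact Or.inr ⟨hx, show (x : ℝ) < 2 * z - 0 by linarith⟩
  have hinter : 0 < (θ.prod θ) (W ∩ Prod.swap ⁻¹' W) := by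
    have hJ : J ×ˢ J ⊆ W ∩ Prod.swap ⁻¹' W := by
      rintro ⟨x, z⟩ ⟨⟨hx₁, hx₂⟩, hz₁, hz₂⟩
      have hp : (0 : ℝ) < (1 / 2) ^ (k + 1) := by positivity
      have hs : (1 / 2 : ℝ) ^ k = 2 * (1 / 2) ^ (k + 1) := by ring
      dsimp only at hx₁ hx₂ hz₁ hz₂
      exact ⟨⟨hp.trans hz₁, show (z : ℝ) < 2 * x - 0 by linarith⟩,
        hp.trans hx₁, show (x : ℝ) < 2 * z - 0 by linarith⟩
    refine lt_of_lt_of_le ?_ (measure_mono hJ)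
    rw [Measure.prod_prod]
    exact ENNReal.mul_pos hk.ne' hk.ne'
  calc (1 : ℝ≥0∞) < 1 + (θ.prod θ) (W ∩ Prod.swap ⁻¹' W) :=
        ENNReal.lt_add_right ENNReal.one_ne_top hinter.ne'
    _ = 2 * (θ.prod θ) W := by
        rw [← hunion, measure_union_add_inter W (measurable_swap hW), hswap, two_mul]

lemma iUnion_closerThanInitial :
    ⋃ n : ℕ, closerThanInitial (1 / ((n : ℝ) + 1)) = closerThanInitial 0 := by
  refine Set.Subset.antisymm
    (Set.iUnion_subset fun n => closerThanInitial_anti (by positivity)) ?_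
  rintro p ⟨h₁, h₂⟩
  obtain ⟨n, hn⟩ := exists_nat_one_div_lt (lt_min h₁ (by linarith : 0 < 2 * (p.1 : ℝ) - p.2))
  obtain ⟨hn₁, hn₂⟩ := lt_min_iff.1 hn
  exact Set.mem_iUnion.2 ⟨n, hn₁, by linarith⟩

theorem stmt_14 :
    ¬ ∃ θ : Measure unitInterval, IsProbabilityMeasure θ ∧
      (∀ A : Set unitInterval, MeasurableSet A → θ A = ∫⁻ x, K22 θ x A ∂θ) ∧
      θ {(0 : unitInterval)} = 0 ∧
      (∀ U : Set unitInterval, IsOpen U → (0 : unitInterval) ∈ U → 0 < θ U) := by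
  rintro ⟨θ, hθ, hinv, h0, hsupp⟩
  have hmono : Monotone fun n : ℕ => closerThanInitial (1 / ((n : ℝ) + 1)) := fun m n h =>
    closerThanInitial_anti (Nat.one_div_le_one_div h)
  refine (one_lt_two_mul_prod_closerThanInitial_zero θ h0).not_ge ?_
  rw [← iUnion_closerThanInitial, hmono.measure_iUnion, ENNReal.mul_iSup]
  exact iSup_le fun n =>
    two_mul_prod_closerThanInitial_le_one θ hinv hsupp Nat.one_div_pos_of_nat
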